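/- Let G be the 7 × 7 real symmetric matrix with all diagonal entries equal to 1 and off-diagonal entries (symmetrically extended) G₁₂ = −1, G₁₃ = −(1/2 + √15/3), G₂₄ = −(1/2 + √15/3), G₁₄ = −1/2, G₂₃ = −1/2, G₃₅ = −1/2, G₄₇ = −1/2, G₅₆ = −1/2, G₆₇ = −1/2, G₅₇ = −1/2, and all other off-diagonal entries 0. Then G has exactly 4 positive eigenvalues (with multiplicity), exactly 1 negative eigenvalue, and exactly 2 zero eigenvalues; equivalently G has rank 5 and signature (4,1). -/

import Mathlib

open Real

noncomputable def G3 : Matrix (Fin 7) (Fin 7) ℝ :=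
  !![1, -1, -(1/2 + Real.sqrt 15 / 3), -(1/2), 0, 0, 0;
     -1, 1, -(1/2), -(1/2 + Real.sqrt 15 / 3), 0, 0, 0;
     -(1/2 + Real.sqrt 15 / 3), -(1/2), 1, 0, -(1/2), 0, 0;
     -(1/2), -(1/2 + Real.sqrt 15 / 3), 0, 1, 0, 0, -(1/2);
     0, 0, -(1/2), 0, 1, -(1/2), -(1/2);
     0, 0, 0, 0, -(1/2), 1, -(1/2);
     0, 0, 0, -(1/2), -(1/2), -(1/2), 1]

/-- The numbers of negative, zero and positive values of a finite family add up to its size. -/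
lemma Finset.card_filter_neg_add_zero_add_pos {n : Type*} [Fintype n] (f : n → ℝ) :
    (Finset.univ.filter fun j ↦ f j < 0).card + (Finset.univ.filter fun j ↦ f j = 0).card +
      (Finset.univ.filter fun j ↦ 0 < f j).card = Fintype.card n := by
  simp only [Finset.card_filter, ← Finset.sum_add_distrib]
  rw [← Finset.card_univ, Finset.card_eq_sum_ones]
  refine Finset.sum_congr rfl fun j _ ↦ ?_
  rcases lt_trichotomy (f j) 0 with h | h | h <;> simp [h, ne_of_gt, ne_of_lt, not_lt_of_gt]

namespace Matrix

variable {n : Type*} [Fintype n] [DecidableEq n]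

/-- A congruence of a matrix with a diagonal one diagonalizes its quadratic form. -/
lemma equivalent_weightedSumSquares_of_eq {A L : Matrix n n ℝ} {w : n → ℝ} (hL : IsUnit L)
    (hA : A = Lᵀ * diagonal w * L) :
    A.toQuadraticForm'.Equivalent (QuadraticMap.weightedSumSquares ℝ w) := by
  refine ⟨⟨LinearEquiv.ofBijective L.mulVecLin
    ⟨mulVec_injective_iff_isUnit.2 hL, mulVec_surjective_iff_isUnit.2 hL⟩, fun v ↦ ?_⟩⟩
  have hv : A.toQuadraticForm' v = v ⬝ᵥ A *ᵥ v := by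
    simp [toQuadraticForm', toLinearMap₂'_apply']
  rw [hv, hA, ← mulVec_mulVec, ← mulVec_mulVec, dotProduct_mulVec, vecMul_transpose]
  simp [dotProduct, mulVec_diagonal, mul_left_comm]
  rfl

/-- The spectral theorem as an equivalence of quadratic forms. -/
lemma IsHermitian.equivalent_weightedSumSquares_eigenvalues {A : Matrix n n ℝ}
    (hA : A.IsHermitian) :
    A.toQuadraticForm'.Equivalent (QuadraticMap.weightedSumSquares ℝ hA.eigenvalues) := by
  refine equivalent_weightedSumSquares_of_eq
    (L := star (hA.eigenvectorUnitary : Matrix n n ℝ))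
    (Unitary.isUnit_coe (U := star hA.eigenvectorUnitary)) ?_
  conv_lhs => rw [hA.spectral_theorem, Unitary.conjStarAlgAut_apply]
  simp [star_eq_conjTranspose]

/-- **Sylvester's law of inertia** for the positive eigenvalues of a real symmetric matrix. -/
lemma IsHermitian.card_pos_eigenvalues_of_eq {A L : Matrix n n ℝ} {w : n → ℝ}
    (hA : A.IsHermitian) (hL : IsUnit L) (h : A = Lᵀ * diagonal w * L) :
    (Finset.univ.filter fun j ↦ 0 < hA.eigenvalues j).card =
      (Finset.univ.filter fun j ↦ 0 < w j).card := by
  have h₁ := QuadraticForm.sigPos_of_equiv_weightedSumSquares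
    hA.equivalent_weightedSumSquares_eigenvalues
  have h₂ := QuadraticForm.sigPos_of_equiv_weightedSumSquares
    (equivalent_weightedSumSquares_of_eq hL h)
  simpa [Set.ncard_eq_toFinset_card'] using h₁.symm.trans h₂

/-- **Sylvester's law of inertia** for the negative eigenvalues of a real symmetric matrix. -/
lemma IsHermitian.card_neg_eigenvalues_of_eq {A L : Matrix n n ℝ} {w : n → ℝ}
    (hA : A.IsHermitian) (hL : IsUnit L) (h : A = Lᵀ * diagonal w * L) :
    (Finset.univ.filter fun j ↦ hA.eigenvalues j < 0).card =
      (Finset.univ.filter fun j ↦ w j < 0).card := by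
  have h₁ := QuadraticForm.sigNeg_of_equiv_weightedSumSquares
    hA.equivalent_weightedSumSquares_eigenvalues
  have h₂ := QuadraticForm.sigNeg_of_equiv_weightedSumSquares
    (equivalent_weightedSumSquares_of_eq hL h)
  simpa [Set.ncard_eq_toFinset_card'] using h₁.symm.trans h₂

end Matrix

/-- The rows are the linear forms whose weighted squares sum to the quadratic form of `G3`;
here `c` is the weight `1/2 + √15/3`. -/
noncomputable def G3Forms (c : ℝ) : Matrix (Fin 7) (Fin 7) ℝ :=
  !![1, 0, 0, 0, 0, 0, 0;
     0, 1, 0, 0, 0, 0, 0;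
     -c, -(1/2), 1, 0, -(1/2), 0, 0;
     -(1/2), -c, 0, 1, 0, 0, -(1/2);
     -c, -(1/2), 0, 0, 1, 0, -(3/2);
     0, 0, 0, 0, -(1/2), 1, -(1/2);
     (2 + 6 * c) / 5, (3 + 4 * c) / 5, 0, 0, 0, 0, 1]

/-- The weights of the squares of the linear forms `G3Forms`. -/
noncomputable def G3Weights : Fin 7 → ℝ := ![0, 0, 1, 1, 1/2, 1, -(5/8)]

lemma isUnit_G3Forms (c : ℝ) : IsUnit (G3Forms c) := by
  rw [← Matrix.mulVec_injective_iff_isUnit]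
  refine (injective_iff_map_eq_zero (G3Forms c).mulVecLin).2 fun v hv ↦ ?_
  simp [G3Forms, funext_iff, Fin.forall_fin_succ, dotProduct,
    Fin.sum_univ_succ] at hv
  obtain ⟨h0, h1, h2, h3, h4, h5, h6⟩ := hv
  simp only [h0, h1] at h2 h3 h4 h5 h6
  ext i
  fin_cases i <;> simp <;> linarith

lemma G3_eq_congruence :
    G3 = (G3Forms (1/2 + √15 / 3)).transpose * Matrix.diagonal G3Weights *
      G3Forms (1/2 + √15 / 3) := by
  have hc : (1/2 + √15 / 3) ^ 2 = (1/2 + √15 / 3) + 17/12 := by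
    have := Real.sq_sqrt (show (0 : ℝ) ≤ 15 by norm_num)
    linear_combination this / 9
  rw [G3]
  generalize 1/2 + √15 / 3 = c at hc ⊢
  ext i j
  rw [Matrix.mul_apply]
  simp only [Matrix.mul_diagonal, Matrix.transpose_apply]
  fin_cases i <;> fin_cases j <;>
    simp [G3Forms, G3Weights, Fin.sum_univ_succ] <;> linarith

theorem stmt_3 (hG : G3.IsHermitian) :
    (Finset.univ.filter fun j => 0 < hG.eigenvalues j).card = 4 ∧
    (Finset.univ.filter fun j => hG.eigenvalues j < 0).card = 1 ∧
    (Finset.univ.filter fun j => hG.eigenvalues j = 0).card = 2 ∧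
    G3.rank = 5 := by
  have hpos := hG.card_pos_eigenvalues_of_eq (isUnit_G3Forms _) G3_eq_congruence
  have hneg := hG.card_neg_eigenvalues_of_eq (isUnit_G3Forms _) G3_eq_congruence
  have hsum := Finset.card_filter_neg_add_zero_add_pos hG.eigenvalues
  have hpos' : (Finset.univ.filter fun j ↦ 0 < G3Weights j).card = 4 := by
    simp [Finset.card_filter, Fin.sum_univ_succ, G3Weights, -Finset.sum_boole]
    norm_num
  have hneg' : (Finset.univ.filter fun j ↦ G3Weights j < 0).card = 1 := by
    simp [Finset.card_filter, Fin.sum_univ_succ, G3Weights, -Finset.sum_boole]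
    norm_num
  have hrank := hG.rank_eq_card_non_zero_eigs
  rw [Fintype.card_subtype_compl, Fintype.card_subtype] at hrank
  simp only [Fintype.card_fin] at hsum hrank
  omega
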